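/- Let 1 → A → B → C → 1 be a split short exact sequence of groups. Then H_2(B; Q) ≅ H_2(C; Q) ⊕ H_1(C; H_1(A; Q)) ⊕ D, where D is the image of the natural map H_2(A; Q) → H_2(B; Q). -/

import Mathlib

/-! Core: group homology via the inhomogeneous bar complex. -/

open Finsupp

namespace GroupHomologyDefs

variable {G : Type} [Group G]

/-- Inhomogeneous `n`-chains of `G` with coefficients in `M`. -/
abbrev Chains (G : Type) [Group G] (M : Rep ℚ G) (n : ℕ) : Type := (Fin n → G) →₀ M

/-- The differential of the inhomogeneous chain complex computing group homology. -/
noncomputable def d (M : Rep ℚ G) (n : ℕ) : Chains G M (n + 1) →ₗ[ℚ] Chains G M n :=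
  Finsupp.lsum ℚ fun g =>
    (Finsupp.lsingle (fun i : Fin n => g i.succ)).comp (M.ρ (g 0)⁻¹ : M →ₗ[ℚ] M) +
      ∑ j : Fin (n + 1),
        ((-1 : ℚ) ^ ((j : ℕ) + 1)) • Finsupp.lsingle (Fin.contractNth j (· * ·) g)

/-- Cycles. -/
noncomputable def cycles (M : Rep ℚ G) (n : ℕ) : Submodule ℚ (Chains G M n) :=
  match n with
  | 0 => ⊤
  | (n + 1) => LinearMap.ker (d M n)

/-- Boundaries. -/
noncomputable def boundaries (M : Rep ℚ G) (n : ℕ) : Submodule ℚ (Chains G M n) :=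
  LinearMap.range (d M n)

/-- Group homology `H_n(G; M)`, defined as cycles modulo boundaries in the inhomogeneous
bar complex. -/
noncomputable def H (M : Rep ℚ G) (n : ℕ) : Type :=
  cycles M n ⧸ (boundaries M n).comap (cycles M n).subtype

noncomputable instance (M : Rep ℚ G) (n : ℕ) : AddCommGroup (H M n) :=
  inferInstanceAs (AddCommGroup
    (cycles M n ⧸ (boundaries M n).comap (cycles M n).subtype))

noncomputable instance (M : Rep ℚ G) (n : ℕ) : Module ℚ (H M n) :=
  inferInstanceAs (Module ℚ
    (cycles M n ⧸ (boundaries M n).comap (cycles M n).subtype))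

variable {G' : Type} [Group G']

/-- The restriction of a representation along a group homomorphism. -/
noncomputable def res (φ : G' →* G) (M : Rep ℚ G) : Rep ℚ G' := Rep.of (M.ρ.comp φ)

/-- A pair `(φ, f)` consisting of a group homomorphism `φ : G' → G` and a linear map
`f : M' → M` is *compatible* if `f` intertwines the two actions. -/
def Compat {M' : Rep ℚ G'} {M : Rep ℚ G} (φ : G' →* G) (f : M' →ₗ[ℚ] M) : Prop :=
  ∀ (g : G') (m : M'), f (M'.ρ g m) = M.ρ (φ g) (f m)

/-- The map on chains induced by a compatible pair. -/
noncomputable def chainsMap (φ : G' →* G) {M' : Rep ℚ G'} {M : Rep ℚ G}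
    (f : M' →ₗ[ℚ] M) (n : ℕ) : Chains G' M' n →ₗ[ℚ] Chains G M n :=
  Finsupp.lsum ℚ fun g => (Finsupp.lsingle (φ ∘ g)).comp f

theorem comp_contractNth (φ : G' →* G) {n : ℕ} (j : Fin (n + 1)) (g : Fin (n + 1) → G') :
    Fin.contractNth j (· * ·) (φ ∘ g) = φ ∘ Fin.contractNth j (· * ·) g := by
  funext k
  rcases lt_trichotomy (k : ℕ) (j : ℕ) with h | h | h
  · simp [Fin.contractNth_apply_of_lt _ _ _ _ h, Function.comp]
  · simp [Fin.contractNth_apply_of_eq _ _ _ _ h, Function.comp]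
  · simp [Fin.contractNth_apply_of_gt _ _ _ _ h, Function.comp]

theorem d_comm (φ : G' →* G) {M' : Rep ℚ G'} {M : Rep ℚ G} (f : M' →ₗ[ℚ] M)
    (hf : Compat φ f) (n : ℕ) :
    (d M n).comp (chainsMap φ f (n + 1)) = (chainsMap φ f n).comp (d M' n) := by
  apply Finsupp.lhom_ext
  intro g m
  have h0 : f (M'.ρ (g 0)⁻¹ m) = M.ρ (φ (g 0))⁻¹ (f m) := by
    simpa [map_inv] using hf (g 0)⁻¹ m
  simp only [LinearMap.comp_apply, chainsMap, d, Finsupp.lsum_single, LinearMap.add_apply,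
    LinearMap.sum_apply, LinearMap.comp_apply, LinearMap.smul_apply, Finsupp.lsingle_apply,
    map_add, map_sum, map_smul, h0]
  simp only [comp_contractNth]
  rfl

theorem chainsMap_cycles_le (φ : G' →* G) {M' : Rep ℚ G'} {M : Rep ℚ G} (f : M' →ₗ[ℚ] M)
    (hf : Compat φ f) (n : ℕ) :
    (cycles M' n).map (chainsMap φ f n) ≤ cycles M n := by
  rcases n with _ | n
  · exact le_top
  · rintro _ ⟨x, hx, rfl⟩
    have := LinearMap.congr_fun (d_comm φ f hf n) x
    simp only [LinearMap.comp_apply] at this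
    simp only [cycles, LinearMap.mem_ker] at hx ⊢
    rw [this, hx, map_zero]

theorem chainsMap_boundaries_le (φ : G' →* G) {M' : Rep ℚ G'} {M : Rep ℚ G} (f : M' →ₗ[ℚ] M)
    (hf : Compat φ f) (n : ℕ) :
    (boundaries M' n).map (chainsMap φ f n) ≤ boundaries M n := by
  rintro _ ⟨x, ⟨y, rfl⟩, rfl⟩
  have := LinearMap.congr_fun (d_comm φ f hf n) y
  simp only [LinearMap.comp_apply] at this
  exact ⟨chainsMap φ f (n + 1) y, this⟩

/-- The map on group homology induced by a compatible pair `(φ, f)`. -/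
noncomputable def Hmap (φ : G' →* G) {M' : Rep ℚ G'} {M : Rep ℚ G} (f : M' →ₗ[ℚ] M)
    (hf : Compat φ f) (n : ℕ) : H M' n →ₗ[ℚ] H M n :=
  Submodule.mapQ _ _
    ((chainsMap φ f n).restrict (p := cycles M' n) (q := cycles M n)
      (fun x hx => chainsMap_cycles_le φ f hf n (Submodule.mem_map_of_mem hx)))
    (by
      intro x hx
      exact chainsMap_boundaries_le φ f hf n (Submodule.mem_map_of_mem hx))

/-- Group homology with trivial rational coefficients. -/
noncomputable abbrev Htriv (G : Type) [Group G] (n : ℕ) : Type := H (Rep.trivial ℚ G ℚ) n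

theorem trivial_compat (φ : G' →* G) :
    Compat (M' := Rep.trivial ℚ G' ℚ) (M := Rep.trivial ℚ G ℚ) φ LinearMap.id := fun _ _ => rfl

/-- The map on group homology with trivial coefficients induced by a group homomorphism. -/
noncomputable def HtrivMap (φ : G' →* G) (n : ℕ) : Htriv G' n →ₗ[ℚ] Htriv G n :=
  Hmap φ LinearMap.id (trivial_compat φ) n

theorem conj_compat (M : Rep ℚ G) (g : G) {N : Subgroup G} [N.Normal] :
    Compat (M' := res N.subtype M) (M := res N.subtype M)
      (MulAut.conjNormal g).toMonoidHom (M.ρ g : M →ₗ[ℚ] M) := by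
  intro x m
  show M.ρ g (M.ρ (x : G) m) = M.ρ (g * x * g⁻¹) (M.ρ g m)
  have h1 : M.ρ g * M.ρ (x : G) = M.ρ (g * x) := (map_mul M.ρ g x).symm
  have h2 : M.ρ (g * x * g⁻¹) * M.ρ g = M.ρ (g * x * g⁻¹ * g) := (map_mul M.ρ _ g).symm
  have h3 : (g * x * g⁻¹) * g = g * x := by group
  calc M.ρ g (M.ρ (x : G) m) = (M.ρ g * M.ρ (x : G)) m := rfl
    _ = M.ρ (g * x) m := by rw [h1]
    _ = M.ρ (g * x * g⁻¹ * g) m := by rw [h3]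
    _ = (M.ρ (g * x * g⁻¹) * M.ρ g) m := by rw [h2]
    _ = M.ρ (g * x * g⁻¹) (M.ρ g m) := rfl

theorem res_compat (φ : G' →* G) (M : Rep ℚ G) :
    Compat (M' := res φ M) (M := M) φ LinearMap.id := fun _ _ => rfl

/-- The coinvariants submodule: the quotient `M ⧸ augSub M` is `H_0(G; M) = M_G`. -/
noncomputable def augSub (M : Rep ℚ G) : Submodule ℚ M :=
  Submodule.span ℚ {x : M | ∃ (g : G) (m : M), x = M.ρ g m - m}

end GroupHomologyDefs

theorem cocycle_shuffle_mul {B W : Type*} [Group B] [AddCommGroup W] {w : B → B → W}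
    (hw : ∀ x y z, w y z + w x (y * z) = w (x * y) z + w x y) {c a₁ a₂ a₁' a₂' : B}
    (h₁ : a₁ * c = c * a₁') (h₂ : a₂ * c = c * a₂') :
    (w a₁ c - w c a₁') + (w a₂ c - w c a₂') - (w (a₁ * a₂) c - w c (a₁' * a₂')) =
      w a₁ a₂ - w a₁' a₂' := by
  have r₁ := hw a₁ a₂ c
  have r₂ := hw c a₁' a₂'
  have r₃ := hw a₁ c a₂'
  rw [h₁] at r₃
  rw [h₂] at r₁
  grind

theorem cocycle_shuffle_mul_left {B W : Type*} [Group B] [AddCommGroup W] {w : B → B → W}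
    (hw : ∀ x y z, w y z + w x (y * z) = w (x * y) z + w x y) {c₁ c₂ a a' a'' : B}
    (h₁ : a * c₁ = c₁ * a') (h₂ : a' * c₂ = c₂ * a'') :
    (w a' c₂ - w c₂ a'') - (w a (c₁ * c₂) - w (c₁ * c₂) a'') + (w a c₁ - w c₁ a') = 0 := by
  have r₁ := hw a c₁ c₂
  have r₂ := hw c₁ c₂ a''
  have r₃ := hw c₁ a' c₂
  rw [h₁] at r₁
  rw [h₂] at r₃
  grind

theorem cocycle_mul_mul {B W : Type*} [Group B] [AddCommGroup W] {w : B → B → W}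
    (hw : ∀ x y z, w y z + w x (y * z) = w (x * y) z + w x y) {c₁ c₂ a₁ a₁' a₂ : B}
    (h : a₁ * c₂ = c₂ * a₁') :
    w (c₁ * a₁) (c₂ * a₂) = (w a₁ c₂ - w c₂ a₁') + w a₁' a₂ + w c₁ c₂ -
      (w c₂ a₂ - w (c₁ * c₂) (a₁' * a₂) + w c₁ a₁) := by
  have r₁ := hw c₁ a₁ (c₂ * a₂)
  have r₂ := hw a₁ c₂ a₂
  have r₃ := hw c₂ a₁' a₂
  have r₄ := hw c₁ c₂ (a₁' * a₂)
  have e : a₁ * (c₂ * a₂) = c₂ * (a₁' * a₂) := by rw [← mul_assoc, h, mul_assoc]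
  rw [e] at r₁
  rw [h] at r₂
  grind

namespace GroupHomologyDefs

section Bar

variable {G G' : Type} [Group G] [Group G']

theorem d_zero_single (M : Rep ℚ G) (g : G) (m : M) :
    d M 0 (single ![g] m) = single ![] (M.ρ g⁻¹ m) - single ![] m := by
  have h (x : Fin 0 → G) : x = ![] := Subsingleton.elim _ _
  simp [d, sub_eq_add_neg, h]

theorem d_one_single (M : Rep ℚ G) (g h : G) (m : M) :
    d M 1 (single ![g, h] m) = single ![h] (M.ρ g⁻¹ m) - single ![g * h] m + single ![g] m := by
  have h0 : (fun _ : Fin 1 => h) = ![h] := by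
    ext i; fin_cases i; rfl
  have h1 : Fin.contractNth 0 (· * ·) (![g, h] : Fin 2 → G) = ![g * h] := by
    ext i; fin_cases i; rfl
  have h2 : Fin.contractNth 1 (· * ·) (![g, h] : Fin 2 → G) = ![g] := by
    ext i; fin_cases i; rfl
  simp [d, Fin.sum_univ_succ, h0, h1, h2]
  abel

theorem d_two_single (M : Rep ℚ G) (g h k : G) (m : M) :
    d M 2 (single ![g, h, k] m) = single ![h, k] (M.ρ g⁻¹ m) - single ![g * h, k] m
      + single ![g, h * k] m - single ![g, h] m := by
  have h1 : Fin.contractNth 0 (· * ·) (![g, h, k] : Fin 3 → G) = ![g * h, k] := by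
    ext i; fin_cases i <;> rfl
  have h2 : Fin.contractNth 1 (· * ·) (![g, h, k] : Fin 3 → G) = ![g, h * k] := by
    ext i; fin_cases i <;> rfl
  have h3 : Fin.contractNth 2 (· * ·) (![g, h, k] : Fin 3 → G) = ![g, h] := by
    ext i; fin_cases i <;> rfl
  simp [d, Fin.sum_univ_succ, h1, h2, h3, pow_succ]
  abel

/-- Inhomogeneous chains with trivial rational coefficients. -/
abbrev TrivChains (G : Type) [Group G] (n : ℕ) : Type := Chains G (Rep.trivial ℚ G ℚ) n

/-- The generator of the bar complex with trivial coefficients attached to a tuple. -/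
noncomputable def bar {n : ℕ} (x : Fin n → G) : TrivChains G n :=
  single x (1 : ℚ)

theorem smul_bar {n : ℕ} (x : Fin n → G) (m : ℚ) :
    m • bar x = (single x m : TrivChains G n) :=
  (Finsupp.smul_single m x (1 : ℚ)).trans (by rw [smul_eq_mul, mul_one])

theorem bar_hom_ext {W : Type*} [AddCommGroup W] [Module ℚ W] {n : ℕ}
    {f g : TrivChains G n →ₗ[ℚ] W} (h : ∀ x, f (bar x) = g (bar x)) : f = g := by
  refine Finsupp.lhom_ext fun x m => ?_
  rw [← smul_bar x m, map_smul, map_smul, h]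

theorem vec_one_eq {α : Type*} (x : Fin 1 → α) : x = ![x 0] := by
  ext i; fin_cases i; rfl

theorem vec_two_eq {α : Type*} (x : Fin 2 → α) : x = ![x 0, x 1] := by
  ext i; fin_cases i <;> rfl

theorem vec_three_eq {α : Type*} (x : Fin 3 → α) : x = ![x 0, x 1, x 2] := by
  ext i; fin_cases i <;> rfl

theorem bar_hom_ext_one {W : Type*} [AddCommGroup W] [Module ℚ W]
    {f g : TrivChains G 1 →ₗ[ℚ] W} (h : ∀ x, f (bar ![x]) = g (bar ![x])) : f = g :=
  bar_hom_ext fun x => by rw [vec_one_eq x, h]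

theorem bar_hom_ext_two {W : Type*} [AddCommGroup W] [Module ℚ W]
    {f g : TrivChains G 2 →ₗ[ℚ] W} (h : ∀ x y, f (bar ![x, y]) = g (bar ![x, y])) : f = g :=
  bar_hom_ext fun x => by rw [vec_two_eq x, h]

theorem bar_hom_ext_three {W : Type*} [AddCommGroup W] [Module ℚ W]
    {f g : TrivChains G 3 →ₗ[ℚ] W} (h : ∀ x y z, f (bar ![x, y, z]) = g (bar ![x, y, z])) :
    f = g :=
  bar_hom_ext fun x => by rw [vec_three_eq x, h]

/-- The linear map out of the bar complex with prescribed values on generators. -/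
noncomputable def barLift {W : Type*} [AddCommGroup W] [Module ℚ W] {n : ℕ}
    (f : (Fin n → G) → W) : TrivChains G n →ₗ[ℚ] W :=
  Finsupp.linearCombination ℚ f

@[simp]
theorem barLift_bar {W : Type*} [AddCommGroup W] [Module ℚ W] {n : ℕ}
    (f : (Fin n → G) → W) (x : Fin n → G) : barLift f (bar x) = f x :=
  (Finsupp.linearCombination_single ℚ (1 : ℚ) x).trans (one_smul ℚ _)

theorem d_zero_trivial : d (Rep.trivial ℚ G ℚ) 0 = 0 := by
  refine bar_hom_ext_one fun g => ?_
  exact (d_zero_single _ g _).trans (sub_self _)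

theorem d_one_bar (g h : G) :
    d (Rep.trivial ℚ G ℚ) 1 (bar ![g, h]) = bar ![h] - bar ![g * h] + bar ![g] :=
  d_one_single _ g h _

theorem d_two_bar (g h k : G) :
    d (Rep.trivial ℚ G ℚ) 2 (bar ![g, h, k]) =
      bar ![h, k] - bar ![g * h, k] + bar ![g, h * k] - bar ![g, h] :=
  d_two_single _ g h k _

theorem d_one_d_two (x : TrivChains G 3) : d (Rep.trivial ℚ G ℚ) 1 (d _ 2 x) = 0 := by
  refine LinearMap.congr_fun (f := d _ 1 ∘ₗ d _ 2) (g := 0) (bar_hom_ext_three fun x y z => ?_) x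
  rw [LinearMap.comp_apply, d_two_bar, LinearMap.zero_apply]
  simp only [map_sub, map_add, d_one_bar, mul_assoc]
  abel

/-- The map of bar complexes induced by a group homomorphism. -/
noncomputable abbrev barMap (φ : G' →* G) (n : ℕ) : TrivChains G' n →ₗ[ℚ] TrivChains G n :=
  chainsMap φ (M' := Rep.trivial ℚ G' ℚ) (M := Rep.trivial ℚ G ℚ) LinearMap.id n

theorem barMap_bar (φ : G' →* G) {n : ℕ} (x : Fin n → G') :
    barMap φ n (bar x) = bar (φ ∘ x) := by
  simp only [barMap, chainsMap, bar]
  erw [Finsupp.lsum_single]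
  rfl

theorem barMap_bar_one (φ : G' →* G) (x : G') : barMap φ 1 (bar ![x]) = bar ![φ x] := by
  rw [barMap_bar]; congr 1; ext i; fin_cases i; rfl

theorem barMap_bar_two (φ : G' →* G) (x y : G') :
    barMap φ 2 (bar ![x, y]) = bar ![φ x, φ y] := by
  rw [barMap_bar]; congr 1; ext i; fin_cases i <;> rfl

theorem barMap_d (φ : G' →* G) (n : ℕ) (x : TrivChains G' (n + 1)) :
    barMap φ n (d _ n x) = d _ n (barMap φ (n + 1) x) :=
  (LinearMap.congr_fun (d_comm (M' := Rep.trivial ℚ G' ℚ) (M := Rep.trivial ℚ G ℚ) φ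
    LinearMap.id (trivial_compat φ) n) x).symm

theorem barMap_injective (φ : G' →* G) (hφ : Function.Injective φ) (n : ℕ) :
    Function.Injective (barMap φ n) := by
  have : barMap φ n = Finsupp.lmapDomain ℚ ℚ (φ ∘ ·) := by
    refine bar_hom_ext fun x => ?_
    rw [barMap_bar]
    exact (Finsupp.mapDomain_single (a := x) (b := (1 : ℚ)) (f := fun x => φ ∘ x)).symm
  rw [this]
  exact Finsupp.mapDomain_injective fun x y h => funext fun i => hφ (congrFun h i)

end Bar

section Homology

variable {G G' : Type} [Group G] [Group G']

/-- The homology class of a cycle. -/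
noncomputable def homologyClass (M : Rep ℚ G) (n : ℕ) : cycles M n →ₗ[ℚ] H M n :=
  Submodule.mkQ _

theorem homologyClass_surjective (M : Rep ℚ G) (n : ℕ) :
    Function.Surjective (homologyClass M n) :=
  Submodule.mkQ_surjective _

theorem homologyClass_eq_zero {M : Rep ℚ G} {n : ℕ} {x : cycles M n} :
    homologyClass M n x = 0 ↔ (x : Chains G M n) ∈ boundaries M n :=
  Submodule.Quotient.mk_eq_zero _

/-- The map on homology induced by a linear map of chains preserving cycles and boundaries. -/
noncomputable def homologyMapOfChains {M : Rep ℚ G} {M' : Rep ℚ G'} {n k : ℕ}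
    (f : Chains G M n →ₗ[ℚ] Chains G' M' k)
    (hc : ∀ x ∈ cycles M n, f x ∈ cycles M' k)
    (hb : ∀ x ∈ boundaries M n, f x ∈ boundaries M' k) : H M n →ₗ[ℚ] H M' k :=
  Submodule.mapQ _ _ (f.restrict hc) fun _ hx => hb _ hx

theorem homologyMapOfChains_class {M : Rep ℚ G} {M' : Rep ℚ G'} {n k : ℕ}
    (f : Chains G M n →ₗ[ℚ] Chains G' M' k)
    (hc : ∀ x ∈ cycles M n, f x ∈ cycles M' k)
    (hb : ∀ x ∈ boundaries M n, f x ∈ boundaries M' k) (x : cycles M n) :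
    homologyMapOfChains f hc hb (homologyClass M n x) =
      homologyClass M' k ⟨f x, hc x x.2⟩ :=
  rfl

theorem barMap_mem_cycles (φ : G' →* G) {n : ℕ} {x : TrivChains G' n}
    (hx : x ∈ cycles _ n) : barMap φ n x ∈ cycles (Rep.trivial ℚ G ℚ) n :=
  chainsMap_cycles_le φ _ (trivial_compat φ) n (Submodule.mem_map_of_mem hx)

theorem HtrivMap_class (φ : G' →* G) (n : ℕ) (x : cycles (Rep.trivial ℚ G' ℚ) n) :
    HtrivMap φ n (homologyClass _ n x) =
      homologyClass _ n ⟨barMap φ n x, barMap_mem_cycles φ x.2⟩ :=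
  rfl

theorem mem_cycles_one (x : TrivChains G 1) : x ∈ cycles (Rep.trivial ℚ G ℚ) 1 := by
  simp [cycles, d_zero_trivial]

/-- The class of a `1`-chain with trivial coefficients. -/
noncomputable def classOne (G : Type) [Group G] : TrivChains G 1 →ₗ[ℚ] Htriv G 1 :=
  homologyClass _ 1 ∘ₗ LinearMap.id.codRestrict _ mem_cycles_one

theorem classOne_surjective : Function.Surjective (classOne G) := by
  intro v
  obtain ⟨x, rfl⟩ := homologyClass_surjective _ _ v
  exact ⟨x, rfl⟩

theorem classOne_eq_zero {x : TrivChains G 1} :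
    classOne G x = 0 ↔ x ∈ boundaries (Rep.trivial ℚ G ℚ) 1 :=
  homologyClass_eq_zero

theorem classOne_bar_mul (g h : G) :
    classOne G (bar ![g * h]) = classOne G (bar ![g]) + classOne G (bar ![h]) := by
  have : classOne G (d _ 1 (bar ![g, h])) = 0 := classOne_eq_zero.2 ⟨_, rfl⟩
  rw [d_one_bar, map_add, map_sub] at this
  rw [← sub_eq_zero, ← neg_eq_zero, ← this]
  abel

theorem classOne_bar_one : classOne G (bar ![1]) = 0 := by
  simpa using classOne_bar_mul (1 : G) 1

theorem HtrivMap_classOne (φ : G' →* G) (x : TrivChains G' 1) :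
    HtrivMap φ 1 (classOne G' x) = classOne G (barMap φ 1 x) :=
  rfl

/-- A linear map on `1`-chains killing boundaries factors through homology. -/
theorem exists_comp_classOne {W : Type*} [AddCommGroup W] [Module ℚ W]
    (f : TrivChains G 1 →ₗ[ℚ] W) (hf : ∀ x, f (d _ 1 x) = 0) :
    ∃ g : Htriv G 1 →ₗ[ℚ] W, ∀ x, g (classOne G x) = f x := by
  refine ⟨Submodule.liftQ _ (f ∘ₗ Submodule.subtype _) ?_, fun _ => rfl⟩
  rintro x ⟨y, hy⟩
  exact (congrArg f hy).symm.trans (hf y)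

end Homology

section Split

variable {B C : Type} [Group B] [Group C] {p : B →* C} {s : C →* B}

/-- The component of `b` in the kernel: `b = s (p b) * kerPart b`. -/
def kerPart (hs : ∀ c, p (s c) = c) (b : B) : p.ker :=
  ⟨(s (p b))⁻¹ * b, by simp [MonoidHom.mem_ker, hs]⟩

/-- The right conjugation action of `C` on the kernel. -/
def kerConj (p : B →* C) (s : C →* B) (c : C) : p.ker →* p.ker :=
  (MulAut.conjNormal (s c⁻¹)).toMonoidHom

theorem coe_kerConj (c : C) (a : p.ker) : (kerConj p s c a : B) = (s c)⁻¹ * a * s c := by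
  simp [kerConj]

theorem mul_eq_mul_kerConj (c : C) (a : p.ker) : (a : B) * s c = s c * kerConj p s c a := by
  rw [coe_kerConj]; group

theorem kerConj_mul (c₁ c₂ : C) (a : p.ker) :
    kerConj p s (c₁ * c₂) a = kerConj p s c₂ (kerConj p s c₁ a) := by
  ext; simp only [coe_kerConj, map_mul]; group

theorem eq_mul_kerPart (hs : ∀ c, p (s c) = c) (b : B) : b = s (p b) * kerPart hs b := by
  simp [kerPart]

theorem kerPart_mul (hs : ∀ c, p (s c) = c) (b₁ b₂ : B) :
    kerPart hs (b₁ * b₂) = kerConj p s (p b₂) (kerPart hs b₁) * kerPart hs b₂ := by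
  ext; simp only [kerPart, Subgroup.coe_mul, coe_kerConj, map_mul]; group

theorem kerPart_coe (hs : ∀ c, p (s c) = c) (a : p.ker) : kerPart hs a = a := by
  have ha : p a = 1 := a.2
  ext; simp [kerPart, ha]

theorem kerPart_section (hs : ∀ c, p (s c) = c) (c : C) : kerPart hs (s c) = 1 := by
  ext; simp [kerPart, hs]

variable {ρN : Representation ℚ C (Htriv p.ker 1)}

theorem rho_inv_classOne (hρN : ∀ c : C, ρN c =
      (HtrivMap (MulAut.conjNormal (s c)).toMonoidHom 1 : Htriv p.ker 1 →ₗ[ℚ] Htriv p.ker 1))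
    (c : C) (x : TrivChains p.ker 1) :
    ρN c⁻¹ (classOne _ x) = classOne _ (barMap (kerConj p s c) 1 x) := by
  rw [hρN, HtrivMap_classOne]; rfl

/-- The chain `(g₁, …, gₙ) ⊗ v` with coefficients in the first homology of the kernel. -/
noncomputable def coeffSingle (ρN : Representation ℚ C (Htriv p.ker 1)) {n : ℕ} (x : Fin n → C) :
    Htriv p.ker 1 →ₗ[ℚ] Chains C (Rep.of ρN) n :=
  Finsupp.lsingle x

theorem coeffSingle_hom_ext {W : Type*} [AddCommGroup W] [Module ℚ W] {n : ℕ}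
    {f g : Chains C (Rep.of ρN) n →ₗ[ℚ] W}
    (h : ∀ x v, f (coeffSingle ρN x v) = g (coeffSingle ρN x v)) : f = g :=
  Finsupp.lhom_ext h

theorem d_zero_coeffSingle (c : C) (v : Htriv p.ker 1) :
    d (Rep.of ρN) 0 (coeffSingle ρN ![c] v) =
      coeffSingle ρN ![] (ρN c⁻¹ v) - coeffSingle ρN ![] v :=
  d_zero_single (Rep.of ρN) c v

theorem d_one_coeffSingle (c₁ c₂ : C) (v : Htriv p.ker 1) :
    d (Rep.of ρN) 1 (coeffSingle ρN ![c₁, c₂] v) =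
      coeffSingle ρN ![c₂] (ρN c₁⁻¹ v) - coeffSingle ρN ![c₁ * c₂] v + coeffSingle ρN ![c₁] v :=
  d_one_single (Rep.of ρN) c₁ c₂ v

/-- The chain-level edge map `C₂(B) → C₁(C; H₁(A))`, sending `(b₁, b₂)` to
`p b₂ ⊗ [kerPart b₁]`. -/
noncomputable def edgeChain (hs : ∀ c, p (s c) = c) (ρN : Representation ℚ C (Htriv p.ker 1)) :
    TrivChains B 2 →ₗ[ℚ] Chains C (Rep.of ρN) 1 :=
  barLift fun x => coeffSingle ρN ![p (x 1)] (classOne _ (bar ![kerPart hs (x 0)]))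

theorem edgeChain_bar (hs : ∀ c, p (s c) = c) (b₁ b₂ : B) :
    edgeChain hs ρN (bar ![b₁, b₂]) =
      coeffSingle ρN ![p b₂] (classOne _ (bar ![kerPart hs b₁])) :=
  barLift_bar _ _

section

variable (hs : ∀ c, p (s c) = c)
  (hρN : ∀ c : C, ρN c =
    (HtrivMap (MulAut.conjNormal (s c)).toMonoidHom 1 : Htriv p.ker 1 →ₗ[ℚ] Htriv p.ker 1))

theorem exists_edgeChain_d_two (hρN : ∀ c : C, ρN c =
      (HtrivMap (MulAut.conjNormal (s c)).toMonoidHom 1 : Htriv p.ker 1 →ₗ[ℚ] Htriv p.ker 1)) :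
    ∃ g : TrivChains B 3 →ₗ[ℚ] Chains C (Rep.of ρN) 2,
      ∀ x, edgeChain hs ρN (d _ 2 x) = d _ 1 (g x) := by
  refine ⟨barLift fun x => -coeffSingle ρN ![p (x 1), p (x 2)]
    (classOne _ (bar ![kerPart hs (x 0)])), LinearMap.congr_fun
      (f := edgeChain hs ρN ∘ₗ d _ 2) (g := d _ 1 ∘ₗ _) (bar_hom_ext_three fun x y z => ?_)⟩
  rw [LinearMap.comp_apply, LinearMap.comp_apply, barLift_bar, d_two_bar]
  simp only [map_sub, map_add, map_neg, edgeChain_bar, Matrix.cons_val_zero, Matrix.cons_val_one,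
    Matrix.cons_val, d_one_coeffSingle, rho_inv_classOne hρN, barMap_bar_one, kerPart_mul, map_mul,
    classOne_bar_mul]
  abel

theorem exists_d_zero_edgeChain (hρN : ∀ c : C, ρN c =
      (HtrivMap (MulAut.conjNormal (s c)).toMonoidHom 1 : Htriv p.ker 1 →ₗ[ℚ] Htriv p.ker 1)) :
    ∃ g : TrivChains B 1 →ₗ[ℚ] Chains C (Rep.of ρN) 0,
      ∀ x, d _ 0 (edgeChain hs ρN x) = g (d _ 1 x) := by
  let g : TrivChains B 1 →ₗ[ℚ] Chains C (Rep.of ρN) 0 :=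
    barLift fun x => -coeffSingle ρN ![] (classOne _ (bar ![kerPart hs (x 0)]))
  refine ⟨g, LinearMap.congr_fun (f := d _ 0 ∘ₗ edgeChain hs ρN) (g := g ∘ₗ d _ 1)
    (bar_hom_ext_two fun x y => ?_)⟩
  have h : d _ 0 (edgeChain hs ρN (bar ![x, y])) = _ :=
    (congrArg (d (Rep.of ρN) 0) (edgeChain_bar hs x y)).trans (d_zero_coeffSingle _ _)
  rw [LinearMap.comp_apply, LinearMap.comp_apply, d_one_bar, h]
  simp only [map_sub, map_add, Matrix.cons_val_zero, g, barLift_bar,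
    rho_inv_classOne hρN, barMap_bar_one, kerPart_mul, classOne_bar_mul]
  abel

/-- The edge map `H₂(B) → H₁(C; H₁(A))`. -/
noncomputable def edge : Htriv B 2 →ₗ[ℚ] H (Rep.of ρN) 1 :=
  homologyMapOfChains (edgeChain hs ρN)
    (fun x hx => by
      obtain ⟨g, hg⟩ := exists_d_zero_edgeChain hs hρN
      have hx : d _ 1 x = 0 := hx
      change d _ 0 _ = 0
      rw [hg, hx, map_zero])
    (fun x hx => by
      obtain ⟨g, hg⟩ := exists_edgeChain_d_two hs hρN
      obtain ⟨y, rfl⟩ := hx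
      exact ⟨g y, (hg y).symm⟩)

theorem edge_section (x : Htriv C 2) : edge hs hρN (HtrivMap s 2 x) = 0 := by
  obtain ⟨x, rfl⟩ := homologyClass_surjective _ _ x
  rw [HtrivMap_class, edge, homologyMapOfChains_class, homologyClass_eq_zero]
  have : edgeChain hs ρN ∘ₗ barMap s 2 = 0 := by
    refine bar_hom_ext_two fun x y => ?_
    rw [LinearMap.comp_apply, barMap_bar_two, edgeChain_bar, kerPart_section, classOne_bar_one,
      map_zero, LinearMap.zero_apply]
  have h := LinearMap.congr_fun this x
  change edgeChain hs ρN (barMap s 2 x) = 0 at h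
  change edgeChain hs ρN (barMap s 2 x) ∈ _
  rw [h]
  exact zero_mem _

theorem edgeChain_ker_mem (x : TrivChains p.ker 2) :
    edgeChain hs ρN (barMap p.ker.subtype 2 x) ∈ boundaries (Rep.of ρN) 1 := by
  suffices h : ∃ g : TrivChains p.ker 2 →ₗ[ℚ] Chains C (Rep.of ρN) 2,
      ∀ x, edgeChain hs ρN (barMap p.ker.subtype 2 x) = d _ 1 (g x) by
    obtain ⟨g, hg⟩ := h
    exact ⟨g x, (hg x).symm⟩
  refine ⟨barLift fun x => coeffSingle ρN ![1, 1] (classOne _ (bar ![x 0])),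
    LinearMap.congr_fun (f := edgeChain hs ρN ∘ₗ barMap p.ker.subtype 2) (g := d _ 1 ∘ₗ _)
      (bar_hom_ext_two fun x y => ?_)⟩
  have hy : p y = 1 := y.2
  rw [LinearMap.comp_apply, LinearMap.comp_apply, barLift_bar, barMap_bar_two, edgeChain_bar]
  simp [kerPart_coe, d_one_coeffSingle, hy]

theorem edge_ker (x : Htriv p.ker 2) : edge hs hρN (HtrivMap p.ker.subtype 2 x) = 0 := by
  obtain ⟨x, rfl⟩ := homologyClass_surjective _ _ x
  rw [HtrivMap_class, edge, homologyMapOfChains_class, homologyClass_eq_zero]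
  exact edgeChain_ker_mem hs _

theorem exists_edgeChain_eq (hρN : ∀ c : C, ρN c =
      (HtrivMap (MulAut.conjNormal (s c)).toMonoidHom 1 : Htriv p.ker 1 →ₗ[ℚ] Htriv p.ker 1))
    (z : Chains C (Rep.of ρN) 1) :
    ∃ (x : TrivChains B 2) (e : TrivChains p.ker 1), edgeChain hs ρN x = z ∧
      d _ 1 x = barMap p.ker.subtype 1 e ∧ coeffSingle ρN ![] (classOne _ e) = -d _ 0 z := by
  induction z using Finsupp.induction_linear with
  | zero => exact ⟨0, 0, by simp⟩
  | add z z' h h' =>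
    obtain ⟨x, e, h₁, h₂, h₃⟩ := h
    obtain ⟨x', e', h₁', h₂', h₃'⟩ := h'
    refine ⟨x + x', e + e', by rw [map_add, h₁, h₁'], by simp only [map_add, h₂, h₂'], ?_⟩
    rw [map_add, map_add, map_add, h₃, h₃', neg_add]
  | single c v =>
    obtain ⟨e, rfl⟩ := classOne_surjective (G := p.ker) v
    rw [vec_one_eq c]
    generalize c 0 = c
    let E : TrivChains p.ker 1 →ₗ[ℚ] TrivChains B 2 := barLift fun x =>
      bar ![(x 0 : B), s c] - bar ![s c, (kerConj p s c (x 0) : B)]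
    have h₁ : edgeChain hs ρN ∘ₗ E = coeffSingle ρN ![c] ∘ₗ classOne _ := by
      refine bar_hom_ext_one fun a => ?_
      simp only [LinearMap.comp_apply, E, barLift_bar, map_sub, edgeChain_bar,
        Matrix.cons_val_zero, kerPart_coe, kerPart_section, classOne_bar_one, map_zero, sub_zero,
        hs]
    have h₂ : d _ 1 ∘ₗ E =
        barMap p.ker.subtype 1 ∘ₗ (LinearMap.id - barMap (kerConj p s c) 1) := by
      refine bar_hom_ext_one fun a => ?_
      simp only [LinearMap.comp_apply, E, barLift_bar, map_sub, LinearMap.sub_apply,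
        Matrix.cons_val_zero, d_one_bar, LinearMap.id_apply, barMap_bar_one, mul_eq_mul_kerConj,
        Subgroup.subtype_apply]
      abel
    refine ⟨E e, e - barMap (kerConj p s c) 1 e, LinearMap.congr_fun h₁ e,
      LinearMap.congr_fun h₂ e, ?_⟩
    refine Eq.trans ?_ (congrArg Neg.neg (d_zero_coeffSingle c (classOne _ e))).symm
    rw [rho_inv_classOne hρN, map_sub, map_sub, neg_sub]

theorem edge_surjective : Function.Surjective (edge hs hρN) := by
  intro z
  obtain ⟨⟨z, hz⟩, rfl⟩ := homologyClass_surjective _ _ z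
  replace hz : d _ 0 z = 0 := hz
  obtain ⟨x, e, h₁, h₂, h₃⟩ := exists_edgeChain_eq hs hρN z
  have he : classOne _ e = 0 := by
    rw [hz, neg_zero] at h₃
    exact Finsupp.single_eq_zero.1 h₃
  obtain ⟨w, rfl⟩ := classOne_eq_zero.1 he
  refine ⟨homologyClass _ 2 ⟨x - barMap p.ker.subtype 2 w, ?_⟩, ?_⟩
  · change d _ 1 _ = 0
    rw [map_sub, h₂, barMap_d, sub_self]
  · rw [edge, homologyMapOfChains_class, ← sub_eq_zero, ← map_sub, homologyClass_eq_zero]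
    change edgeChain hs ρN (x - barMap p.ker.subtype 2 w) - z ∈ _
    rw [map_sub, h₁, sub_sub_cancel_left]
    exact neg_mem (edgeChain_ker_mem hs w)

theorem exists_lift_shuffle (hρN : ∀ c : C, ρN c =
      (HtrivMap (MulAut.conjNormal (s c)).toMonoidHom 1 : Htriv p.ker 1 →ₗ[ℚ] Htriv p.ker 1))
    {W : Type*} [AddCommGroup W] [Module ℚ W] {w : B → B → W}
    (hw : ∀ x y z, w y z + w x (y * z) = w (x * y) z + w x y)
    (hw_ker : ∀ a a' : p.ker, w a a' = 0) :
    ∃ E : Chains C (Rep.of ρN) 1 →ₗ[ℚ] W, (∀ z, E (d _ 1 z) = 0) ∧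
      ∀ c (a : p.ker), E (coeffSingle ρN ![c] (classOne _ (bar ![a]))) =
        w a (s c) - w (s c) (kerConj p s c a) := by
  have key (c : C) : ∃ g : Htriv p.ker 1 →ₗ[ℚ] W, ∀ a : p.ker,
      g (classOne _ (bar ![a])) = w a (s c) - w (s c) (kerConj p s c a) := by
    let E : TrivChains p.ker 1 →ₗ[ℚ] W :=
      barLift fun x => w (x 0) (s c) - w (s c) (kerConj p s c (x 0))
    have hE (a : p.ker) : E (bar ![a]) = w a (s c) - w (s c) (kerConj p s c a) :=
      barLift_bar _ _
    obtain ⟨g, hg⟩ := exists_comp_classOne E <| LinearMap.congr_fun (f := E ∘ₗ d _ 1) (g := 0) <|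
      bar_hom_ext_two fun a₁ a₂ => by
        have := cocycle_shuffle_mul hw (mul_eq_mul_kerConj (s := s) c a₁)
          (mul_eq_mul_kerConj (s := s) c a₂)
        rw [hw_ker, hw_ker, sub_zero] at this
        rw [LinearMap.comp_apply, d_one_bar, map_add, map_sub, hE, hE, hE, LinearMap.zero_apply,
          ← this, map_mul, Subgroup.coe_mul, Subgroup.coe_mul]
        abel
    exact ⟨g, fun a => (hg _).trans (hE a)⟩
  choose g hg using key
  let E : Chains C (Rep.of ρN) 1 →ₗ[ℚ] W := Finsupp.lsum ℚ fun x => g (x 0)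
  have hE (c : C) (v) : E (coeffSingle ρN ![c] v) = g c v := Finsupp.lsum_single ℚ _ _ _
  refine ⟨E, LinearMap.congr_fun (f := E ∘ₗ d _ 1) (g := 0) <|
    coeffSingle_hom_ext fun x v => ?_, fun c a => (hE c _).trans (hg c a)⟩
  obtain ⟨e, rfl⟩ := classOne_surjective (G := p.ker) v
  rw [vec_two_eq x]
  refine LinearMap.congr_fun (f := (E ∘ₗ d _ 1) ∘ₗ coeffSingle ρN ![x 0, x 1] ∘ₗ classOne _)
    (g := 0) (bar_hom_ext_one fun a => ?_) e
  have := cocycle_shuffle_mul_left hw (mul_eq_mul_kerConj (s := s) (x 0) a)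
    (mul_eq_mul_kerConj (s := s) (x 1) (kerConj p s (x 0) a))
  refine (congrArg E (d_one_coeffSingle (x 0) (x 1) (classOne _ (bar ![a])))).trans ?_
  simp only [map_add, map_sub, hE, LinearMap.zero_apply, rho_inv_classOne hρN, barMap_bar_one, hg,
    kerConj_mul, map_mul]
  exact this

theorem mem_sup_of_edgeChain_mem (hρN : ∀ c : C, ρN c =
      (HtrivMap (MulAut.conjNormal (s c)).toMonoidHom 1 : Htriv p.ker 1 →ₗ[ℚ] Htriv p.ker 1))
    {y : TrivChains B 2} (hy : d _ 1 y = 0) (hpy : barMap p 2 y ∈ boundaries _ 2)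
    (hey : edgeChain hs ρN y ∈ boundaries _ 1) :
    y ∈ boundaries _ 2 ⊔ LinearMap.range (barMap p.ker.subtype 2) := by
  set S := boundaries (Rep.trivial ℚ B ℚ) 2 ⊔ LinearMap.range (barMap p.ker.subtype 2)
  have hd (x : TrivChains B 3) : S.mkQ (d _ 2 x) = 0 :=
    (Submodule.Quotient.mk_eq_zero _).2 (Submodule.mem_sup_left ⟨x, rfl⟩)
  let w (x y : B) := S.mkQ (bar ![x, y])
  have hw (x y z : B) : w y z + w x (y * z) = w (x * y) z + w x y := by
    have := hd (bar ![x, y, z])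
    rw [d_two_bar, map_sub, map_add, map_sub] at this
    rw [← sub_eq_zero, ← this]
    abel
  have hw_ker (a a' : p.ker) : w a a' = 0 := (Submodule.Quotient.mk_eq_zero _).2
    (Submodule.mem_sup_right ⟨bar ![a, a'], barMap_bar_two _ _ _⟩)
  obtain ⟨E, hE, hE_single⟩ := exists_lift_shuffle hρN hw hw_ker
  let T : TrivChains B 1 →ₗ[ℚ] _ := barLift fun x => w (s (p (x 0))) (kerPart hs (x 0))
  have hT (b : B) : T (bar ![b]) = w (s (p b)) (kerPart hs b) := barLift_bar _ _
  have key : S.mkQ =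
      E ∘ₗ edgeChain hs ρN + S.mkQ ∘ₗ barMap s 2 ∘ₗ barMap p 2 - T ∘ₗ d _ 1 := by
    refine bar_hom_ext_two fun b₁ b₂ => ?_
    have h := cocycle_mul_mul hw (c₁ := s (p b₁)) (a₂ := kerPart hs b₂)
      (mul_eq_mul_kerConj (s := s) (p b₂) (kerPart hs b₁))
    rw [← eq_mul_kerPart, ← eq_mul_kerPart, hw_ker, add_zero] at h
    simp only [LinearMap.sub_apply, LinearMap.add_apply, LinearMap.comp_apply, edgeChain_bar,
      hE_single, barMap_bar_two, d_one_bar, map_add, map_sub, hT, kerPart_mul, map_mul,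
      Subgroup.coe_mul]
    exact h
  rw [← Submodule.Quotient.mk_eq_zero]
  obtain ⟨z, hz⟩ := hpy
  obtain ⟨η, hη⟩ := hey
  refine (LinearMap.congr_fun key y).trans ?_
  simp only [LinearMap.sub_apply, LinearMap.add_apply, LinearMap.comp_apply, hy, ← hz, ← hη,
    barMap_d, hd, hE, map_zero, add_zero, sub_zero]

theorem mem_range_of_edge_eq_zero {y : Htriv B 2} (hpy : HtrivMap p 2 y = 0)
    (hey : edge hs hρN y = 0) : y ∈ LinearMap.range (HtrivMap p.ker.subtype 2) := by
  obtain ⟨⟨y, hy⟩, rfl⟩ := homologyClass_surjective _ _ y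
  rw [HtrivMap_class, homologyClass_eq_zero] at hpy
  rw [edge, homologyMapOfChains_class, homologyClass_eq_zero] at hey
  obtain ⟨_, ⟨x, rfl⟩, _, ⟨w, rfl⟩, h⟩ :=
    Submodule.mem_sup.1 (mem_sup_of_edgeChain_mem hs hρN hy hpy hey)
  replace hy : d _ 1 y = 0 := hy
  have hdx : d _ 1 (d (Rep.trivial ℚ B ℚ) 2 x) = 0 := d_one_d_two x
  have hw : d _ 1 w = 0 := by
    apply barMap_injective p.ker.subtype p.ker.subtype_injective
    rw [barMap_d, map_zero, ← hy, ← h, map_add, hdx, zero_add]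
  refine ⟨homologyClass _ 2 ⟨w, hw⟩, ?_⟩
  rw [HtrivMap_class, eq_comm, ← sub_eq_zero, ← map_sub, homologyClass_eq_zero]
  refine ⟨x, ?_⟩
  change _ = y - barMap p.ker.subtype 2 w
  rw [← h, add_sub_cancel_right]

theorem HtrivMap_HtrivMap_ker (x : Htriv p.ker 2) :
    HtrivMap p 2 (HtrivMap p.ker.subtype 2 x) = 0 := by
  obtain ⟨⟨x, hx⟩, rfl⟩ := homologyClass_surjective _ _ x
  rw [HtrivMap_class, HtrivMap_class, homologyClass_eq_zero]
  change barMap p 2 (barMap p.ker.subtype 2 x) ∈ _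
  replace hx : d _ 1 x = 0 := hx
  have key : barMap p 2 ∘ₗ barMap p.ker.subtype 2 =
      (barLift fun _ => bar ![1, 1]) ∘ₗ d _ 1 := by
    refine bar_hom_ext_two fun a a' => ?_
    have ha : p a = 1 := a.2
    have ha' : p a' = 1 := a'.2
    rw [LinearMap.comp_apply, LinearMap.comp_apply, barMap_bar_two, barMap_bar_two, d_one_bar,
      map_add, map_sub, barLift_bar, barLift_bar, barLift_bar]
    simp [ha, ha']
  have h := LinearMap.congr_fun key x
  rw [LinearMap.comp_apply, LinearMap.comp_apply, hx, map_zero] at h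
  rw [h]
  exact zero_mem _

theorem HtrivMap_section (hs : ∀ c, p (s c) = c) (x : Htriv C 2) :
    HtrivMap p 2 (HtrivMap s 2 x) = x := by
  obtain ⟨x, rfl⟩ := homologyClass_surjective _ _ x
  rw [HtrivMap_class, HtrivMap_class]
  congr 1
  ext1
  refine LinearMap.congr_fun (f := barMap p 2 ∘ₗ barMap s 2) (g := LinearMap.id)
    (bar_hom_ext_two fun a a' => ?_) x
  rw [LinearMap.comp_apply, barMap_bar_two, barMap_bar_two, hs, hs, LinearMap.id_apply]

end

end Split

end GroupHomologyDefs

open GroupHomologyDefs in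
/-- For a split short exact sequence `1 → A → B → C → 1` (with `A = ker p`),
`H_2(B; ℚ) ≅ H_2(C; ℚ) ⊕ H_1(C; H_1(A; ℚ)) ⊕ D`, where `C` acts on `H_1(A; ℚ)` by conjugation
via the splitting `s`, and `D` is the image of `H_2(A; ℚ) → H_2(B; ℚ)`. -/
theorem stmt4 (B C : Type) [Group B] [Group C] (p : B →* C) (hp : Function.Surjective p)
    (s : C →* B) (hs : ∀ c, p (s c) = c)
    (ρN : Representation ℚ C (Htriv p.ker 1))
    (hρN : ∀ c : C, ρN c =
      (HtrivMap (MulAut.conjNormal (s c)).toMonoidHom 1 : Htriv p.ker 1 →ₗ[ℚ] Htriv p.ker 1)) :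
    Nonempty (Htriv B 2 ≃ₗ[ℚ]
      (Htriv C 2 × H (Rep.of ρN) 1 × LinearMap.range (HtrivMap p.ker.subtype 2))) := by
  let Ψ := (HtrivMap p 2).prod (edge hs hρN)
  have hsurj : Function.Surjective Ψ := by
    rintro ⟨x, z⟩
    obtain ⟨y, rfl⟩ := edge_surjective hs hρN z
    refine ⟨y + HtrivMap s 2 (x - HtrivMap p 2 y), Prod.ext ?_ ?_⟩
    · simp [Ψ, HtrivMap_section hs]
    · simp [Ψ, edge_section]
  have hker : LinearMap.ker Ψ = LinearMap.range (HtrivMap p.ker.subtype 2) := by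
    ext y
    refine ⟨fun hy => ?_, ?_⟩
    · obtain ⟨h₁, h₂⟩ := Prod.ext_iff.1 (LinearMap.mem_ker.1 hy)
      exact mem_range_of_edge_eq_zero hs hρN h₁ h₂
    · rintro ⟨x, rfl⟩
      exact LinearMap.mem_ker.2 (Prod.ext (HtrivMap_HtrivMap_ker x) (edge_ker hs hρN x))
  obtain ⟨e⟩ := quotient_prod_linearEquiv (LinearMap.ker Ψ)
  exact ⟨e.symm ≪≫ₗ (LinearEquiv.prodCongr (Ψ.quotKerEquivOfSurjective hsurj)
    (LinearEquiv.ofEq _ _ hker)) ≪≫ₗ LinearEquiv.prodAssoc ℚ _ _ _⟩
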